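/- arXiv:2202.06160 — 8 statements merged into one kernel-verified Lean document; each statement's English description precedes it below -/
import Mathlib

section
/- Let Γ₁, Γ₂, y₁, y₂ be real numbers satisfying the two equations 2Γ₂·cosh(y₁)·cosh(y₂) = Γ₁·sinh²(y₁) − Γ₁·sinh(y₁)·sinh(y₂) and 2Γ₁·cosh(y₁)·cosh(y₂) = Γ₂·sinh²(y₂) − Γ₂·sinh(y₁)·sinh(y₂). Then either sinh(y₁) = sinh(y₂) (equivalently y₁ = y₂), or Γ₁²·sinh(y₁) + Γ₂²·sinh(y₂) = 0. -/
open Real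

theorem fixed_equilibrium_dichotomy (Γ₁ Γ₂ y₁ y₂ : ℝ)
    (h1 : 2 * Γ₂ * Real.cosh y₁ * Real.cosh y₂
        = Γ₁ * Real.sinh y₁ ^ 2 - Γ₁ * Real.sinh y₁ * Real.sinh y₂)
    (h2 : 2 * Γ₁ * Real.cosh y₁ * Real.cosh y₂
        = Γ₂ * Real.sinh y₂ ^ 2 - Γ₂ * Real.sinh y₁ * Real.sinh y₂) :
    Real.sinh y₁ = Real.sinh y₂ ∨ Γ₁ ^ 2 * Real.sinh y₁ + Γ₂ ^ 2 * Real.sinh y₂ = 0 := by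
  have h : (Real.sinh y₁ - Real.sinh y₂)
      * (Γ₁ ^ 2 * Real.sinh y₁ + Γ₂ ^ 2 * Real.sinh y₂) = 0 := by
    linear_combination Γ₂ * h2 - Γ₁ * h1
  exact (mul_eq_zero.mp h).imp_left sub_eq_zero.mp
end

section
/- Let Γ₁ ≠ 0, Γ₂ ≠ 0 and y₁ ≠ y₂ be real numbers satisfying the two equations 2Γ₂·cosh(y₁)·cosh(y₂) = Γ₁·sinh²(y₁) − Γ₁·sinh(y₁)·sinh(y₂) and 2Γ₁·cosh(y₁)·cosh(y₂) = Γ₂·sinh²(y₂) − Γ₂·sinh(y₁)·sinh(y₂). Then Γ₁·Γ₂ > 0; that is, a fixed equilibrium of two point vortices on the Möbius band can occur only when the two vortex strengths have the same sign. -/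
open Real

theorem fixed_equilibrium_same_sign (Γ₁ Γ₂ y₁ y₂ : ℝ)
    (hΓ₁ : Γ₁ ≠ 0) (hΓ₂ : Γ₂ ≠ 0) (hy : y₁ ≠ y₂)
    (h1 : 2 * Γ₂ * Real.cosh y₁ * Real.cosh y₂
        = Γ₁ * Real.sinh y₁ ^ 2 - Γ₁ * Real.sinh y₁ * Real.sinh y₂)
    (h2 : 2 * Γ₁ * Real.cosh y₁ * Real.cosh y₂
        = Γ₂ * Real.sinh y₂ ^ 2 - Γ₂ * Real.sinh y₁ * Real.sinh y₂) :
    Γ₁ * Γ₂ > 0 := by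
  have hC : 0 < Real.cosh y₁ * Real.cosh y₂ := mul_pos (Real.cosh_pos _) (Real.cosh_pos _)
  have hab : Real.sinh y₁ - Real.sinh y₂ ≠ 0 :=
    sub_ne_zero.mpr fun h => hy (Real.sinh_injective h)
  by_contra hneg
  have hprod : Γ₁ * Γ₂ * (Real.cosh y₁ * Real.cosh y₂) ≤ 0 :=
    mul_nonpos_of_nonpos_of_nonneg (not_lt.mp hneg) hC.le
  have ha : Real.sinh y₁ * (Real.sinh y₁ - Real.sinh y₂) ≤ 0 := by
    have h : Γ₁ ^ 2 * (Real.sinh y₁ * (Real.sinh y₁ - Real.sinh y₂)) ≤ 0 := by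
      linear_combination 2 * hprod - Γ₁ * h1
    exact nonpos_of_mul_nonpos_right h (by positivity)
  have hb : Real.sinh y₂ * (Real.sinh y₂ - Real.sinh y₁) ≤ 0 := by
    have h : Γ₂ ^ 2 * (Real.sinh y₂ * (Real.sinh y₂ - Real.sinh y₁)) ≤ 0 := by
      linear_combination 2 * hprod - Γ₂ * h2
    exact nonpos_of_mul_nonpos_right h (by positivity)
  have hsq : 0 < (Real.sinh y₁ - Real.sinh y₂) ^ 2 := by positivity
  linarith
end

section
/- Let Γ₁, Γ₂ be real numbers with Γ₁·Γ₂ > 0 and Γ₁ ≠ Γ₂. Then there exist real numbers y₁, y₂ with y₁·y₂ < 0 (in particular y₁ ≠ y₂) satisfying the two equations 2Γ₂·cosh(y₁)·cosh(y₂) = Γ₁·sinh²(y₁) − Γ₁·sinh(y₁)·sinh(y₂) and 2Γ₁·cosh(y₁)·cosh(y₂) = Γ₂·sinh²(y₂) − Γ₂·sinh(y₁)·sinh(y₂). Consequently the two-vortex system on the Möbius band with strengths Γ₁, Γ₂ has a fixed equilibrium with x₁ = x₂ and heights y₁, y₂. -/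
open Real

theorem exists_pos_quadratic_root {a b c : ℝ} (ha : 0 < a) (hb : 0 < b) (hc : 0 < c) :
    ∃ v : ℝ, 0 < v ∧ a * v ^ 2 = b * v + c := by
  obtain ⟨d, hd₀, hd⟩ : ∃ d : ℝ, 0 ≤ d ∧ d ^ 2 = b ^ 2 + 4 * a * c :=
    ⟨√(b ^ 2 + 4 * a * c), Real.sqrt_nonneg _, Real.sq_sqrt (by positivity)⟩
  refine ⟨(b + d) / (2 * a), by positivity, ?_⟩
  field_simp
  linear_combination hd

theorem fixed_equilibrium_exists (Γ₁ Γ₂ : ℝ) (hsign : Γ₁ * Γ₂ > 0) (hne : Γ₁ ≠ Γ₂) :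
    ∃ y₁ y₂ : ℝ, y₁ * y₂ < 0 ∧
      2 * Γ₂ * Real.cosh y₁ * Real.cosh y₂
        = Γ₁ * Real.sinh y₁ ^ 2 - Γ₁ * Real.sinh y₁ * Real.sinh y₂ ∧
      2 * Γ₁ * Real.cosh y₁ * Real.cosh y₂
        = Γ₂ * Real.sinh y₂ ^ 2 - Γ₂ * Real.sinh y₁ * Real.sinh y₂ := by
  have h₁ : Γ₁ ≠ 0 := left_ne_zero_of_mul hsign.ne'
  have h₂ : Γ₂ ≠ 0 := right_ne_zero_of_mul hsign.ne'
  have hsq : Γ₁ ^ 2 - Γ₂ ^ 2 ≠ 0 := by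
    intro h
    rcases sq_eq_sq_iff_eq_or_eq_neg.mp (sub_eq_zero.mp h) with h | h
    · exact hne h
    · rw [h] at hsign
      nlinarith [sq_nonneg Γ₂]
  obtain ⟨v, hv, hroot⟩ := exists_pos_quadratic_root
    (a := (Γ₁ * Γ₂) ^ 2 * (Γ₁ ^ 2 - Γ₂ ^ 2) ^ 2) (b := 4 * (Γ₁ ^ 4 + Γ₂ ^ 4)) (c := 4)
    (by positivity) (by positivity) (by norm_num)
  have hw : √v ^ 2 = v := Real.sq_sqrt hv.le
  -- The ratio of the two equations forces `sinh y₁ : sinh y₂ = Γ₂ ^ 2 : -Γ₁ ^ 2`.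
  set y₁ := arsinh (Γ₂ ^ 2 * √v) with hy₁
  set y₂ := arsinh (-(Γ₁ ^ 2 * √v)) with hy₂
  have hs₁ : sinh y₁ = Γ₂ ^ 2 * √v := sinh_arsinh _
  have hs₂ : sinh y₂ = -(Γ₁ ^ 2 * √v) := sinh_arsinh _
  have hpos : 0 < y₁ := arsinh_pos_iff.mpr (by positivity)
  have hneg : y₂ < 0 := arsinh_neg_iff.mpr (neg_neg_of_pos (by positivity))
  have hc₁ : cosh y₁ ^ 2 = 1 + Γ₂ ^ 4 * v := by
    rw [cosh_sq, hs₁]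
    linear_combination Γ₂ ^ 4 * hw
  have hc₂ : cosh y₂ ^ 2 = 1 + Γ₁ ^ 4 * v := by
    rw [cosh_sq, hs₂]
    linear_combination Γ₁ ^ 4 * hw
  have hcosh : 2 * (cosh y₁ * cosh y₂) = Γ₁ * Γ₂ * (Γ₁ ^ 2 + Γ₂ ^ 2) * v := by
    have := cosh_pos y₁
    have := cosh_pos y₂
    refine (sq_eq_sq₀ (by positivity) (by positivity)).mp ?_
    rw [mul_pow, mul_pow, hc₁, hc₂]
    linear_combination -hroot
  refine ⟨y₁, y₂, mul_neg_of_pos_of_neg hpos hneg, ?_, ?_⟩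
  · rw [hs₁, hs₂]
    linear_combination Γ₂ * hcosh - Γ₁ * Γ₂ ^ 2 * (Γ₁ ^ 2 + Γ₂ ^ 2) * hw
  · rw [hs₁, hs₂]
    linear_combination Γ₁ * hcosh - Γ₂ * Γ₁ ^ 2 * (Γ₁ ^ 2 + Γ₂ ^ 2) * hw
end

section
/- Let Γ₁ > Γ₂ > 0 and C, x₁, x₂ be real numbers. For t ∈ ℝ set y₂(t) = (C − Γ₁·t)/Γ₂, and let X₁(t), X₂(t) be the horizontal velocities of the two vortices obtained by substituting y₁ = t, y₂ = y₂(t) into the two-vortex equations of motion on the Möbius band. Then as t → +∞, X₁(t) tends to −(2Γ₂ − Γ₁)/(4π) and X₂(t) tends to −Γ₂/(4π). -/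
open Real Filter

theorem tendsto_cosh_atTop : Tendsto Real.cosh atTop atTop := by
  refine tendsto_atTop_mono (f := fun x => Real.exp x / 2) (fun x => ?_)
    (Real.tendsto_exp_atTop.atTop_div_const two_pos)
  rw [Real.cosh_eq]
  linarith [Real.exp_pos (-x)]

theorem tendsto_tanh_atTop_one : Tendsto Real.tanh atTop (nhds 1) := by
  have hq : Tendsto (fun x : ℝ => Real.exp (-x) / Real.cosh x) atTop (nhds 0) :=
    Real.tendsto_exp_neg_atTop_nhds_zero.div_atTop tendsto_cosh_atTop
  have h := hq.const_sub 1
  rw [sub_zero] at h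
  refine h.congr fun x => ?_
  have hc := (Real.cosh_pos x).ne'
  rw [Real.tanh_eq_sinh_div_cosh, ← Real.cosh_sub_sinh]
  field_simp
  ring

theorem tendsto_tanh_atBot_neg_one : Tendsto Real.tanh atBot (nhds (-1)) := by
  have h := (tendsto_tanh_atTop_one.comp tendsto_neg_atBot_atTop).neg
  exact h.congr fun x => by simp [Real.tanh_neg]

theorem tendsto_sinh_div_add_sinh_half_sq_atTop (a : ℝ) :
    Tendsto (fun u : ℝ => Real.sinh u / (a + Real.sinh (u / 2) ^ 2)) atTop (nhds 2) := by
  have hq : Tendsto (fun u : ℝ => (2 * a - 1) / Real.cosh u) atTop (nhds 0) :=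
    tendsto_const_nhds.div_atTop tendsto_cosh_atTop
  have h := (tendsto_tanh_atTop_one.const_mul 2).div (hq.const_add 1) (by norm_num)
  norm_num at h
  refine h.congr fun u => ?_
  have hc := (Real.cosh_pos u).ne'
  have hs : a + Real.sinh (u / 2) ^ 2 = (Real.cosh u * (1 + (2 * a - 1) / Real.cosh u)) / 2 := by
    have h1 := Real.cosh_two_mul (u / 2)
    have h2 := Real.cosh_sq (u / 2)
    rw [mul_div_cancel₀ u two_ne_zero] at h1
    field_simp
    linarith
  rw [Pi.div_apply, hs, Real.tanh_eq_sinh_div_cosh, div_div_eq_mul_div, ← div_div]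
  congr 1
  ring

theorem tendsto_sinh_div_add_sinh_half_sq_atBot (a : ℝ) :
    Tendsto (fun u : ℝ => Real.sinh u / (a + Real.sinh (u / 2) ^ 2)) atBot (nhds (-2)) := by
  have h := ((tendsto_sinh_div_add_sinh_half_sq_atTop a).comp tendsto_neg_atBot_atTop).neg
  exact h.congr fun u => by simp [neg_div]

/-- Asymptotic motion of two vortices: with `Γ₁ > Γ₂ > 0`, momentum
`Γ₁y₁ + Γ₂y₂ = C`, as `y₁ → +∞` (so `y₂ → −∞`) the horizontal velocities tend to
`−(2Γ₂ − Γ₁)/(4π)` and `−Γ₂/(4π)` respectively. -/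
theorem asymptotic_two_vortex_velocities (Γ₁ Γ₂ C x₁ x₂ : ℝ)
    (h12 : Γ₂ < Γ₁) (h2 : 0 < Γ₂) :
    Tendsto (fun t : ℝ =>
        -(1 / (8 * π)) *
          (Γ₂ * Real.sinh (t - (C - Γ₁ * t) / Γ₂) /
              (Real.sin ((x₁ - x₂) / 2) ^ 2 + Real.sinh ((t - (C - Γ₁ * t) / Γ₂) / 2) ^ 2)
            - Γ₂ * Real.sinh (t + (C - Γ₁ * t) / Γ₂) /
                (Real.cos ((x₁ - x₂) / 2) ^ 2 + Real.sinh ((t + (C - Γ₁ * t) / Γ₂) / 2) ^ 2)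
            - 2 * Γ₁ * Real.tanh t))
      atTop (nhds (-(2 * Γ₂ - Γ₁) / (4 * π)))
    ∧
    Tendsto (fun t : ℝ =>
        -(1 / (8 * π)) *
          (Γ₁ * Real.sinh ((C - Γ₁ * t) / Γ₂ - t) /
              (Real.sin ((x₂ - x₁) / 2) ^ 2 + Real.sinh (((C - Γ₁ * t) / Γ₂ - t) / 2) ^ 2)
            - Γ₁ * Real.sinh ((C - Γ₁ * t) / Γ₂ + t) /
                (Real.cos ((x₂ - x₁) / 2) ^ 2 + Real.sinh (((C - Γ₁ * t) / Γ₂ + t) / 2) ^ 2)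
            - 2 * Γ₂ * Real.tanh ((C - Γ₁ * t) / Γ₂)))
      atTop (nhds (-Γ₂ / (4 * π))) := by
  have h1 : 0 < Γ₁ := h2.trans h12
  have affine_atTop : ∀ a b : ℝ, 0 < a → Tendsto (fun t : ℝ => a * t + b) atTop atTop :=
    fun a b ha => tendsto_atTop_add_const_right _ b (tendsto_id.const_mul_atTop ha)
  have affine_atBot : ∀ a b : ℝ, a < 0 → Tendsto (fun t : ℝ => a * t + b) atTop atBot :=
    fun a b ha => tendsto_atBot_add_const_right _ b (tendsto_id.const_mul_atTop_of_neg ha)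
  have hy : Tendsto (fun t : ℝ => (C - Γ₁ * t) / Γ₂) atTop atBot :=
    (affine_atBot (-(Γ₁ / Γ₂)) (C / Γ₂) (neg_lt_zero.2 (div_pos h1 h2))).congr
      fun t => by field_simp; ring
  have hsum : Tendsto (fun t : ℝ => t + (C - Γ₁ * t) / Γ₂) atTop atBot :=
    (affine_atBot (1 - Γ₁ / Γ₂) (C / Γ₂) (sub_neg.2 ((one_lt_div h2).2 h12))).congr
      fun t => by field_simp; ring
  have hsum' : Tendsto (fun t : ℝ => (C - Γ₁ * t) / Γ₂ + t) atTop atBot :=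
    hsum.congr fun t => add_comm _ _
  have hdiff : Tendsto (fun t : ℝ => t - (C - Γ₁ * t) / Γ₂) atTop atTop :=
    (affine_atTop (1 + Γ₁ / Γ₂) (-(C / Γ₂)) (by positivity)).congr
      fun t => by field_simp; ring
  have hdiff' : Tendsto (fun t : ℝ => (C - Γ₁ * t) / Γ₂ - t) atTop atBot :=
    (tendsto_neg_atTop_atBot.comp hdiff).congr fun t => neg_sub _ _
  constructor
  · simp only [mul_div_assoc]
    have h := (((((tendsto_sinh_div_add_sinh_half_sq_atTop
        (Real.sin ((x₁ - x₂) / 2) ^ 2)).comp hdiff).const_mul Γ₂).sub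
      (((tendsto_sinh_div_add_sinh_half_sq_atBot
        (Real.cos ((x₁ - x₂) / 2) ^ 2)).comp hsum).const_mul Γ₂)).sub
      (tendsto_tanh_atTop_one.const_mul (2 * Γ₁))).const_mul (-(1 / (8 * π)))
    have hlim : -(2 * Γ₂ - Γ₁) / (4 * π) = -(1 / (8 * π)) * (Γ₂ * 2 - Γ₂ * -2 - 2 * Γ₁ * 1) := by
      field_simp
      ring
    rw [hlim]
    exact h
  · simp only [mul_div_assoc]
    have h := (((((tendsto_sinh_div_add_sinh_half_sq_atBot
        (Real.sin ((x₂ - x₁) / 2) ^ 2)).comp hdiff').const_mul Γ₁).sub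
      (((tendsto_sinh_div_add_sinh_half_sq_atBot
        (Real.cos ((x₂ - x₁) / 2) ^ 2)).comp hsum').const_mul Γ₁)).sub
      ((tendsto_tanh_atBot_neg_one.comp hy).const_mul (2 * Γ₂))).const_mul (-(1 / (8 * π)))
    have hlim : -Γ₂ / (4 * π) = -(1 / (8 * π)) * (Γ₁ * -2 - Γ₁ * -2 - 2 * Γ₂ * -1) := by
      field_simp
      ring
    rw [hlim]
    exact h
end

section
/- Let Γ₁, Γ₂ > 0 and C ∈ ℝ, and let H(u,y) be the reduced two-vortex Hamiltonian on the Möbius band. Fix y and u such that sin²(u/2) + sinh²((y/2)(1+Γ₁/Γ₂) − C/(2Γ₂)) ≠ 0 and cos²(u/2) + sinh²((y/2)(1−Γ₁/Γ₂) + C/(2Γ₂)) ≠ 0. Then the partial derivative of H with respect to u at (u,y) equals −(Γ₁Γ₂·sin(u)/(8π))·[ 1/(sin²(u/2) + sinh²((y/2)(1+Γ₁/Γ₂) − C/(2Γ₂))) + 1/(cos²(u/2) + sinh²((y/2)(1−Γ₁/Γ₂) + C/(2Γ₂))) ]; in particular ∂H/∂u(u,y) = 0 if and only if sin(u) = 0.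 -/
open Real

/-- The reduced two-vortex Hamiltonian on the Möbius band, where `u = x₁ − x₂`,
`y = y₁` and `C = Γ₁y₁ + Γ₂y₂` is the conserved momentum. -/
noncomputable def reducedHamiltonian (Γ₁ Γ₂ C u y : ℝ) : ℝ :=
  -(Γ₁ * Γ₂ / (4 * π)) *
      Real.log ((Real.sin (u / 2) ^ 2
            + Real.sinh ((y / 2) * (1 + Γ₁ / Γ₂) - C / (2 * Γ₂)) ^ 2) /
          (Real.cos (u / 2) ^ 2
            + Real.sinh ((y / 2) * (1 - Γ₁ / Γ₂) + C / (2 * Γ₂)) ^ 2))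
    + (Γ₁ ^ 2 / (4 * π)) * Real.log (Real.cosh y)
    + (Γ₂ ^ 2 / (4 * π)) * Real.log (Real.cosh ((C - Γ₁ * y) / Γ₂))

theorem hasDerivAt_sin_half_sq_add (k u : ℝ) :
    HasDerivAt (fun v => Real.sin (v / 2) ^ 2 + k) (Real.sin u / 2) u := by
  refine ((((hasDerivAt_id u).div_const 2).sin.pow 2).add_const k).congr_deriv ?_
  have h : Real.sin u = 2 * Real.sin (u / 2) * Real.cos (u / 2) := by
    rw [← Real.sin_two_mul, mul_div_cancel₀ u two_ne_zero]
  simp only [id, h]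
  push_cast
  ring

theorem hasDerivAt_cos_half_sq_add (k u : ℝ) :
    HasDerivAt (fun v => Real.cos (v / 2) ^ 2 + k) (-(Real.sin u / 2)) u := by
  refine (hasDerivAt_sin_half_sq_add (-(1 + k)) u).neg.congr_of_eventuallyEq
    (.of_forall fun v => ?_)
  simp only [Pi.neg_apply, Real.cos_sq']
  ring

/-- The partial derivative of the reduced Hamiltonian in `u` is
`−(Γ₁Γ₂ sin u/(8π))·[1/(sin²(u/2)+sinh²(⋯)) + 1/(cos²(u/2)+sinh²(⋯))]`; in particular
it vanishes exactly when `sin u = 0`. -/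
theorem reducedHamiltonian_deriv_u (Γ₁ Γ₂ C u y : ℝ) (hΓ₁ : 0 < Γ₁) (hΓ₂ : 0 < Γ₂)
    (hA : Real.sin (u / 2) ^ 2
        + Real.sinh ((y / 2) * (1 + Γ₁ / Γ₂) - C / (2 * Γ₂)) ^ 2 ≠ 0)
    (hB : Real.cos (u / 2) ^ 2
        + Real.sinh ((y / 2) * (1 - Γ₁ / Γ₂) + C / (2 * Γ₂)) ^ 2 ≠ 0) :
    HasDerivAt (fun v => reducedHamiltonian Γ₁ Γ₂ C v y)
      (-(Γ₁ * Γ₂ * Real.sin u / (8 * π)) *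
        (1 / (Real.sin (u / 2) ^ 2
            + Real.sinh ((y / 2) * (1 + Γ₁ / Γ₂) - C / (2 * Γ₂)) ^ 2)
          + 1 / (Real.cos (u / 2) ^ 2
              + Real.sinh ((y / 2) * (1 - Γ₁ / Γ₂) + C / (2 * Γ₂)) ^ 2))) u
    ∧
    ((-(Γ₁ * Γ₂ * Real.sin u / (8 * π)) *
        (1 / (Real.sin (u / 2) ^ 2
            + Real.sinh ((y / 2) * (1 + Γ₁ / Γ₂) - C / (2 * Γ₂)) ^ 2)
          + 1 / (Real.cos (u / 2) ^ 2
              + Real.sinh ((y / 2) * (1 - Γ₁ / Γ₂) + C / (2 * Γ₂)) ^ 2))) = 0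
      ↔ Real.sin u = 0) := by
  refine ⟨?_, ?_⟩
  · have hlog := ((hasDerivAt_sin_half_sq_add
        (Real.sinh ((y / 2) * (1 + Γ₁ / Γ₂) - C / (2 * Γ₂)) ^ 2) u).div
      (hasDerivAt_cos_half_sq_add
        (Real.sinh ((y / 2) * (1 - Γ₁ / Γ₂) + C / (2 * Γ₂)) ^ 2) u) hB).log (div_ne_zero hA hB)
    refine (((hlog.const_mul (-(Γ₁ * Γ₂ / (4 * π)))).add_const
      ((Γ₁ ^ 2 / (4 * π)) * Real.log (Real.cosh y))).add_const
      ((Γ₂ ^ 2 / (4 * π)) * Real.log (Real.cosh ((C - Γ₁ * y) / Γ₂)))).congr_deriv ?_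
    simp only [Pi.div_apply]
    generalize Real.sin (u / 2) ^ 2 + _ = A at hA ⊢
    generalize Real.cos (u / 2) ^ 2 + _ = B at hB ⊢
    have hπ := Real.pi_ne_zero
    field_simp
    ring
  · have hA' := lt_of_le_of_ne (by positivity) hA.symm
    have hB' := lt_of_le_of_ne (by positivity) hB.symm
    rw [mul_eq_zero, or_iff_left (add_pos (one_div_pos.2 hA') (one_div_pos.2 hB')).ne']
    simp [hΓ₁.ne', hΓ₂.ne', Real.pi_ne_zero]
end

section
/- Let Γ₁ > Γ₂ > 0 and C ∈ ℝ, and let H(u,y) be the reduced two-vortex Hamiltonian on the Möbius band. Then for every fixed u ∈ ℝ, the function y ↦ H(u,y) tends to +∞ as y → +∞ and as y → −∞. -/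
open Real Filter

lemma abs_sub_log_two_le_log_cosh (x : ℝ) : |x| - log 2 ≤ log (cosh x) := by
  rw [← cosh_abs, ← log_exp |x|, ← log_div (exp_pos _).ne' two_ne_zero, log_exp, cosh_eq]
  exact log_le_log (by positivity) (by linarith [exp_pos (-|x|)])

lemma cosh_sq_le_exp_two_mul_abs (x : ℝ) : cosh x ^ 2 ≤ exp (2 * |x|) := by
  have h : cosh x ≤ exp |x| := by
    rw [← cosh_abs, cosh_eq]
    linarith [exp_le_exp.2 (neg_le_self (abs_nonneg x))]
  calc cosh x ^ 2 ≤ exp |x| ^ 2 := pow_le_pow_left₀ (cosh_pos x).le h 2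
    _ = exp (2 * |x|) := by rw [← exp_nat_mul]; norm_num

lemma exp_two_mul_abs_le_sinh_sq {x : ℝ} (hx : 1 ≤ |x|) :
    exp (2 * |x|) / 16 ≤ sinh x ^ 2 := by
  have h : exp |x| / 4 ≤ sinh |x| := by
    rw [sinh_eq]
    linarith [add_one_le_exp |x|, exp_le_one_iff.2 (neg_nonpos.2 (abs_nonneg x))]
  calc exp (2 * |x|) / 16 = (exp |x| / 4) ^ 2 := by
        rw [div_pow, ← exp_nat_mul]; norm_num
    _ ≤ sinh |x| ^ 2 := pow_le_pow_left₀ (by positivity) h 2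
    _ = sinh x ^ 2 := by rw [← abs_sinh, sq_abs]

lemma log_sinh_sq_ratio_le (v : ℝ) {A B : ℝ} (hA : A ≠ 0) (hB : 1 ≤ |B|) :
    log ((sin v ^ 2 + sinh A ^ 2) / (cos v ^ 2 + sinh B ^ 2)) ≤
      2 * |A| - 2 * |B| + log 16 := by
  have hsA : 0 < sinh A ^ 2 := by
    have := sinh_ne_zero.2 hA
    positivity
  have hD : exp (2 * |B|) / 16 ≤ cos v ^ 2 + sinh B ^ 2 := by
    linarith [exp_two_mul_abs_le_sinh_sq hB, sq_nonneg (cos v)]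
  have hN : sin v ^ 2 + sinh A ^ 2 ≤ exp (2 * |A|) := by
    linarith [cosh_sq_le_exp_two_mul_abs A, cosh_sq A, sin_sq_le_one v]
  have hN0 : 0 < sin v ^ 2 + sinh A ^ 2 := by positivity
  have hE : 0 < exp (2 * |B|) / 16 := by positivity
  rw [log_div hN0.ne' (hE.trans_le hD).ne']
  have h1 := log_le_log hN0 hN
  have h2 := log_le_log hE hD
  rw [log_div (exp_pos _).ne' (by norm_num), log_exp] at h2
  rw [log_exp] at h1
  linarith

/-- Away from a bounded set of heights, the reduced Hamiltonian is bounded below by an affine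
function of `|y|`, whose slope is positive when `Γ₂ < Γ₁`. -/
lemma le_reducedHamiltonian {Γ₁ Γ₂ : ℝ} (C u : ℝ) {y : ℝ} (h12 : Γ₂ < Γ₁) (h2 : 0 < Γ₂)
    (hy : |C| / Γ₂ + 2 ≤ (Γ₁ / Γ₂ - 1) * |y|) :
    Γ₁ * (Γ₁ - Γ₂) / (4 * π) * |y| -
        (Γ₁ * Γ₂ / (4 * π) * (2 * (|C| / Γ₂) + log 16) + Γ₁ ^ 2 / (4 * π) * log 2 +
          Γ₂ ^ 2 / (4 * π) * (|C| / Γ₂ + log 2)) ≤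
      reducedHamiltonian Γ₁ Γ₂ C u y := by
  have h1 : 0 < Γ₁ := h2.trans h12
  have hr : 1 < Γ₁ / Γ₂ := (one_lt_div h2).2 h12
  have hc : |C / Γ₂| = |C| / Γ₂ := by rw [abs_div, abs_of_pos h2]
  have hc0 : 0 ≤ |C| / Γ₂ := by positivity
  set A := (y / 2) * (1 + Γ₁ / Γ₂) - C / (2 * Γ₂) with hAdef
  set B := (y / 2) * (1 - Γ₁ / Γ₂) + C / (2 * Γ₂) with hBdef
  have hA2 : 2 * A = (1 + Γ₁ / Γ₂) * y - C / Γ₂ := by rw [hAdef]; field_simp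
  have hB2 : 2 * B = C / Γ₂ - (Γ₁ / Γ₂ - 1) * y := by rw [hBdef]; field_simp; ring
  have hZ2 : (C - Γ₁ * y) / Γ₂ = C / Γ₂ - Γ₁ / Γ₂ * y := by field_simp
  have eA : |(1 + Γ₁ / Γ₂) * y| = (1 + Γ₁ / Γ₂) * |y| := by
    rw [abs_mul, abs_of_pos (by linarith)]
  have eB : |(Γ₁ / Γ₂ - 1) * y| = (Γ₁ / Γ₂ - 1) * |y| := by
    rw [abs_mul, abs_of_pos (by linarith)]
  have eZ : |Γ₁ / Γ₂ * y| = Γ₁ / Γ₂ * |y| := by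
    rw [abs_mul, abs_of_pos (by linarith)]
  have absA : 2 * |A| = |(1 + Γ₁ / Γ₂) * y - C / Γ₂| := by rw [← hA2, abs_mul, abs_two]
  have absB : 2 * |B| = |C / Γ₂ - (Γ₁ / Γ₂ - 1) * y| := by rw [← hB2, abs_mul, abs_two]
  have upA := abs_sub ((1 + Γ₁ / Γ₂) * y) (C / Γ₂)
  have loA := abs_sub_abs_le_abs_sub ((1 + Γ₁ / Γ₂) * y) (C / Γ₂)
  have loB := abs_sub_abs_le_abs_sub ((Γ₁ / Γ₂ - 1) * y) (C / Γ₂)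
  have loZ := abs_sub_abs_le_abs_sub (Γ₁ / Γ₂ * y) (C / Γ₂)
  rw [abs_sub_comm] at loB loZ
  rw [← absA, eA, hc] at upA loA
  rw [← absB, eB, hc] at loB
  rw [← hZ2, eZ, hc] at loZ
  have hA : A ≠ 0 := abs_pos.1 (by nlinarith [abs_nonneg y])
  have hlog := log_sinh_sq_ratio_le (u / 2) hA (B := B) (by linarith)
  have hcy := abs_sub_log_two_le_log_cosh y
  have hcz := abs_sub_log_two_le_log_cosh ((C - Γ₁ * y) / Γ₂)
  have hratio : log ((sin (u / 2) ^ 2 + sinh A ^ 2) / (cos (u / 2) ^ 2 + sinh B ^ 2)) ≤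
      2 * |y| + (2 * (|C| / Γ₂) + log 16) := by linarith
  have hcz' : Γ₁ / Γ₂ * |y| - (|C| / Γ₂ + log 2) ≤ log (cosh ((C - Γ₁ * y) / Γ₂)) := by
    linarith
  have t1 := mul_le_mul_of_nonneg_left hratio (by positivity : 0 ≤ Γ₁ * Γ₂ / (4 * π))
  have t2 := mul_le_mul_of_nonneg_left hcy (by positivity : 0 ≤ Γ₁ ^ 2 / (4 * π))
  have t3 := mul_le_mul_of_nonneg_left hcz' (by positivity : 0 ≤ Γ₂ ^ 2 / (4 * π))
  have slope : Γ₁ * (Γ₁ - Γ₂) / (4 * π) * |y| = -(Γ₁ * Γ₂ / (4 * π) * (2 * |y|)) +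
      Γ₁ ^ 2 / (4 * π) * |y| + Γ₂ ^ 2 / (4 * π) * (Γ₁ / Γ₂ * |y|) := by
    field_simp
    ring
  rw [mul_add (Γ₁ * Γ₂ / (4 * π)) (2 * |y|)] at t1
  rw [mul_sub] at t2 t3
  unfold reducedHamiltonian
  rw [slope]
  linarith

/-- Along any filter on which `|y| → ∞`, the reduced Hamiltonian tends to `+∞`. -/
lemma tendsto_reducedHamiltonian_of_abs {Γ₁ Γ₂ : ℝ} (C u : ℝ) (h12 : Γ₂ < Γ₁) (h2 : 0 < Γ₂)
    {l : Filter ℝ} (hl : Tendsto (fun y : ℝ => |y|) l atTop) :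
    Tendsto (fun y => reducedHamiltonian Γ₁ Γ₂ C u y) l atTop := by
  have hr : 0 < Γ₁ / Γ₂ - 1 := sub_pos.2 ((one_lt_div h2).2 h12)
  have hK : 0 < Γ₁ * (Γ₁ - Γ₂) / (4 * π) :=
    div_pos (mul_pos (h2.trans h12) (sub_pos.2 h12)) (by positivity)
  refine tendsto_atTop_mono' l ?_
    (tendsto_atTop_add_const_right l
      (-(Γ₁ * Γ₂ / (4 * π) * (2 * (|C| / Γ₂) + log 16) + Γ₁ ^ 2 / (4 * π) * log 2 +
          Γ₂ ^ 2 / (4 * π) * (|C| / Γ₂ + log 2))) (hl.const_mul_atTop hK))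
  filter_upwards [(hl.const_mul_atTop hr).eventually_ge_atTop (|C| / Γ₂ + 2)] with y hy
  rw [← sub_eq_add_neg]
  exact le_reducedHamiltonian C u h12 h2 hy

/-- For `Γ₁ > Γ₂ > 0`, the reduced Hamiltonian tends to `+∞` as `y → ±∞`, for every
fixed `u`. -/
theorem reducedHamiltonian_tendsto_atTop (Γ₁ Γ₂ C : ℝ) (h12 : Γ₂ < Γ₁) (h2 : 0 < Γ₂)
    (u : ℝ) :
    Tendsto (fun y => reducedHamiltonian Γ₁ Γ₂ C u y) atTop atTop ∧
    Tendsto (fun y => reducedHamiltonian Γ₁ Γ₂ C u y) atBot atTop := by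
  exact ⟨tendsto_reducedHamiltonian_of_abs C u h12 h2 tendsto_abs_atTop_atTop,
    tendsto_reducedHamiltonian_of_abs C u h12 h2 tendsto_abs_atBot_atTop⟩
end

section
/- Let Γ₁ > Γ₂ > 0 and C ∈ ℝ, let H(u,y) be the reduced two-vortex Hamiltonian on the Möbius band, and set g(y) = H(0,y) and c = C/(Γ₁+Γ₂). Then g is differentiable on ℝ \ {c}, g(y) → +∞ as y → c (from either side), and g(y) → +∞ as y → ±∞; consequently there exist real numbers y₋ < c < y₊ with g′(y₋) = 0 and g′(y₊) = 0. In particular the two-vortex system has at least two relative equilibria with x₁ = x₂ for each value C of the momentum. -/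
open Real Filter

theorem reducedHamiltonian_zero_eq (Γ₁ Γ₂ C y : ℝ) :
    reducedHamiltonian Γ₁ Γ₂ C 0 y =
      -(Γ₁ * Γ₂ / (4 * π)) *
        Real.log (Real.sinh ((y / 2) * (1 + Γ₁ / Γ₂) - C / (2 * Γ₂)) ^ 2 /
          Real.cosh ((y / 2) * (1 - Γ₁ / Γ₂) + C / (2 * Γ₂)) ^ 2)
      + (Γ₁ ^ 2 / (4 * π)) * Real.log (Real.cosh y)
      + (Γ₂ ^ 2 / (4 * π)) * Real.log (Real.cosh ((C - Γ₁ * y) / Γ₂)) := by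
  simp [reducedHamiltonian, Real.cosh_sq' ((y / 2) * (1 - Γ₁ / Γ₂) + C / (2 * Γ₂))]

theorem sinh_collision_eq_zero_iff {Γ₁ Γ₂ : ℝ} (C y : ℝ) (h1 : 0 < Γ₁) (h2 : 0 < Γ₂) :
    Real.sinh ((y / 2) * (1 + Γ₁ / Γ₂) - C / (2 * Γ₂)) = 0 ↔ y = C / (Γ₁ + Γ₂) := by
  have h : (y / 2) * (1 + Γ₁ / Γ₂) - C / (2 * Γ₂) = (y * (Γ₁ + Γ₂) - C) / (2 * Γ₂) := by
    field_simp
    ring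
  have hs : Γ₁ + Γ₂ ≠ 0 := by positivity
  have h2' : 2 * Γ₂ ≠ 0 := by positivity
  rw [Real.sinh_eq_zero, h, div_eq_zero_iff, or_iff_left h2', sub_eq_zero, eq_div_iff hs]

theorem abs_sub_log_two_le_log_cosh_s17 (x : ℝ) : |x| - Real.log 2 ≤ Real.log (Real.cosh x) := by
  rw [← Real.log_exp |x|, ← Real.log_div (Real.exp_ne_zero _) two_ne_zero, ← Real.cosh_abs x]
  apply Real.log_le_log (by positivity)
  rw [Real.cosh_eq]
  linarith [Real.exp_pos (-|x|)]

theorem log_sinh_le_abs (x : ℝ) : Real.log (Real.sinh x) ≤ |x| := by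
  rcases eq_or_ne x 0 with rfl | hx
  · simp
  have h : 0 < |Real.sinh x| := abs_pos.2 (Real.sinh_ne_zero.2 hx)
  rw [← Real.log_abs, Real.log_le_iff_le_exp h, Real.abs_sinh, Real.sinh_eq]
  linarith [Real.exp_pos (-|x|), Real.exp_pos |x|]

theorem le_reducedHamiltonian_zero {Γ₁ Γ₂ C y : ℝ} (h1 : 0 < Γ₁) (h2 : 0 < Γ₂)
    (hy : y ≠ C / (Γ₁ + Γ₂)) :
    Γ₁ * (Γ₁ - Γ₂) / (4 * π) * |y|
        - (Γ₂ * |C| + (Γ₁ + Γ₂) ^ 2 * Real.log 2) / (4 * π)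
      ≤ reducedHamiltonian Γ₁ Γ₂ C 0 y := by
  rw [reducedHamiltonian_zero_eq]
  have hsinh := mt (sinh_collision_eq_zero_iff C y h1 h2).1 hy
  set a := (y / 2) * (1 + Γ₁ / Γ₂) - C / (2 * Γ₂) with ha
  set b := (y / 2) * (1 - Γ₁ / Γ₂) + C / (2 * Γ₂) with hb
  have hlog : Real.log (Real.sinh a ^ 2 / Real.cosh b ^ 2) ≤ 2 * |y| + 2 * Real.log 2 := by
    rw [Real.log_div (pow_ne_zero 2 hsinh) (pow_ne_zero 2 (Real.cosh_pos b).ne'),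
      Real.log_pow, Real.log_pow]
    have hab : |a| - |b| ≤ |y| := by
      have h := abs_sub_abs_le_abs_sub a (-b)
      rwa [abs_neg, show a - -b = y by rw [ha, hb]; ring] at h
    push_cast
    linarith [log_sinh_le_abs a, abs_sub_log_two_le_log_cosh_s17 b]
  have hz : Γ₁ * |y| - |C| ≤ Γ₂ * |(C - Γ₁ * y) / Γ₂| := by
    rw [abs_div, abs_of_pos h2, mul_div_cancel₀ _ h2.ne']
    have h := abs_sub_abs_le_abs_sub (Γ₁ * y) C
    rwa [abs_mul, abs_of_pos h1, abs_sub_comm] at h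
  have key : Γ₁ * (Γ₁ - Γ₂) * |y| - (Γ₂ * |C| + (Γ₁ + Γ₂) ^ 2 * Real.log 2)
      ≤ -(Γ₁ * Γ₂) * Real.log (Real.sinh a ^ 2 / Real.cosh b ^ 2)
        + Γ₁ ^ 2 * Real.log (Real.cosh y)
        + Γ₂ ^ 2 * Real.log (Real.cosh ((C - Γ₁ * y) / Γ₂)) := by
    have e1 := mul_le_mul_of_nonneg_left hlog (mul_pos h1 h2).le
    have e2 := mul_le_mul_of_nonneg_left (abs_sub_log_two_le_log_cosh_s17 y) (sq_nonneg Γ₁)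
    have e3 := mul_le_mul_of_nonneg_left
      (abs_sub_log_two_le_log_cosh_s17 ((C - Γ₁ * y) / Γ₂)) (sq_nonneg Γ₂)
    have e4 := mul_le_mul_of_nonneg_left hz h2.le
    linarith
  have h := div_le_div_of_nonneg_right key (by positivity : 0 ≤ 4 * π)
  refine le_trans (le_of_eq ?_) (h.trans (le_of_eq ?_)) <;> ring

theorem tendsto_reducedHamiltonian_zero_of_abs {Γ₁ Γ₂ : ℝ} (C : ℝ) (h12 : Γ₂ < Γ₁)
    (h2 : 0 < Γ₂) {l : Filter ℝ} (hl : Tendsto (fun y : ℝ => |y|) l atTop) :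
    Tendsto (fun y => reducedHamiltonian Γ₁ Γ₂ C 0 y) l atTop := by
  have h1 : 0 < Γ₁ := h2.trans h12
  have hk : 0 < Γ₁ * (Γ₁ - Γ₂) / (4 * π) :=
    div_pos (mul_pos h1 (sub_pos.2 h12)) (by positivity)
  refine tendsto_atTop_mono' l ?_ (tendsto_atTop_add_const_right l
    (-((Γ₂ * |C| + (Γ₁ + Γ₂) ^ 2 * Real.log 2) / (4 * π))) (hl.const_mul_atTop hk))
  filter_upwards [hl.eventually_gt_atTop |C / (Γ₁ + Γ₂)|] with y hy
  rw [← sub_eq_add_neg]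
  exact le_reducedHamiltonian_zero h1 h2 (fun h => hy.ne' (by rw [h]))

theorem differentiableOn_reducedHamiltonian_zero {Γ₁ Γ₂ : ℝ} (C : ℝ) (h1 : 0 < Γ₁)
    (h2 : 0 < Γ₂) :
    DifferentiableOn ℝ (fun y => reducedHamiltonian Γ₁ Γ₂ C 0 y) {C / (Γ₁ + Γ₂)}ᶜ := by
  intro y hy
  have hsinh := mt (sinh_collision_eq_zero_iff C y h1 h2).1 hy
  have hcosh : ∀ x : ℝ, Real.cosh x ≠ 0 := fun x => (Real.cosh_pos x).ne'
  simp only [reducedHamiltonian_zero_eq]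
  refine DifferentiableAt.differentiableWithinAt ?_
  refine .add (.add (.const_mul (.log (.div ?_ ?_ ?_) ?_) _)
    (.const_mul (.log ?_ (hcosh _)) _)) (.const_mul (.log ?_ ?_) _)
  · fun_prop
  · fun_prop
  · exact pow_ne_zero 2 (hcosh _)
  · exact div_ne_zero (pow_ne_zero 2 hsinh) (pow_ne_zero 2 (hcosh _))
  · fun_prop
  · fun_prop
  · exact hcosh _

theorem tendsto_reducedHamiltonian_zero_collision {Γ₁ Γ₂ : ℝ} (C : ℝ) (h1 : 0 < Γ₁)
    (h2 : 0 < Γ₂) :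
    Tendsto (fun y => reducedHamiltonian Γ₁ Γ₂ C 0 y)
      (nhdsWithin (C / (Γ₁ + Γ₂)) {C / (Γ₁ + Γ₂)}ᶜ) atTop := by
  have hcosh : ∀ x : ℝ, Real.cosh x ≠ 0 := fun x => (Real.cosh_pos x).ne'
  simp only [reducedHamiltonian_zero_eq, add_assoc]
  set c := C / (Γ₁ + Γ₂) with hc
  have hratio : Tendsto (fun y => Real.sinh ((y / 2) * (1 + Γ₁ / Γ₂) - C / (2 * Γ₂)) ^ 2 /
      Real.cosh ((y / 2) * (1 - Γ₁ / Γ₂) + C / (2 * Γ₂)) ^ 2)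
      (nhdsWithin c {c}ᶜ) (nhdsWithin 0 {0}ᶜ) := by
    refine tendsto_nhdsWithin_iff.2 ⟨?_, ?_⟩
    · have hcont : Continuous
          (fun y => Real.sinh ((y / 2) * (1 + Γ₁ / Γ₂) - C / (2 * Γ₂)) ^ 2 /
            Real.cosh ((y / 2) * (1 - Γ₁ / Γ₂) + C / (2 * Γ₂)) ^ 2) :=
        .div (by fun_prop) (by fun_prop) fun _ => pow_ne_zero 2 (hcosh _)
      refine (hcont.tendsto' c 0 ?_).mono_left nhdsWithin_le_nhds
      rw [(sinh_collision_eq_zero_iff C c h1 h2).2 hc]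
      simp
    · filter_upwards [self_mem_nhdsWithin] with y hy
      exact div_ne_zero (pow_ne_zero 2 (mt (sinh_collision_eq_zero_iff C y h1 h2).1 hy))
        (pow_ne_zero 2 (hcosh _))
  have hk : -(Γ₁ * Γ₂ / (4 * π)) < 0 := neg_lt_zero.2 (by positivity)
  refine ((Real.tendsto_log_nhdsNE_zero.comp hratio).const_mul_atBot_of_neg hk).atTop_add
    (C := (Γ₁ ^ 2 / (4 * π)) * Real.log (Real.cosh c)
      + (Γ₂ ^ 2 / (4 * π)) * Real.log (Real.cosh ((C - Γ₁ * c) / Γ₂))) ?_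
  have hcont : Continuous (fun y => (Γ₁ ^ 2 / (4 * π)) * Real.log (Real.cosh y)
      + (Γ₂ ^ 2 / (4 * π)) * Real.log (Real.cosh ((C - Γ₁ * y) / Γ₂))) :=
    .add (.mul (by fun_prop) (.log (by fun_prop) fun _ => hcosh _))
      (.mul (by fun_prop) (.log (by fun_prop) fun _ => hcosh _))
  exact (hcont.tendsto c).mono_left nhdsWithin_le_nhds

theorem exists_deriv_eq_zero_of_lt_endpoints {f : ℝ → ℝ} {p x q : ℝ}
    (hf : ContinuousOn f (Set.Icc p q)) (hx : x ∈ Set.Ioo p q) (hp : f x < f p)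
    (hq : f x < f q) : ∃ z ∈ Set.Ioo p q, deriv f z = 0 := by
  have hx' := Set.Ioo_subset_Icc_self hx
  obtain ⟨z, hz, hmin⟩ := isCompact_Icc.exists_isMinOn ⟨x, hx'⟩ hf
  have hzx : f z ≤ f x := hmin hx'
  have hzI : z ∈ Set.Ioo p q := by
    refine ⟨hz.1.lt_of_ne ?_, hz.2.lt_of_ne ?_⟩ <;> rintro rfl <;> linarith
  exact ⟨z, hzI, (hmin.isLocalMin (Icc_mem_nhds hzI.1 hzI.2)).deriv_eq_zero⟩

/-- On the line `u = x₁ − x₂ = 0`, the reduced Hamiltonian `g(y) = H(0,y)` is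
differentiable away from the collision point `c = C/(Γ₁+Γ₂)`, blows up to `+∞` both at
`c` and at `±∞`, and hence has at least two critical points `ym < c < yp`: these give at
least two relative equilibria with `x₁ = x₂` for each momentum value `C`. -/
theorem reducedHamiltonian_critical_points (Γ₁ Γ₂ C : ℝ) (h12 : Γ₂ < Γ₁) (h2 : 0 < Γ₂) :
    DifferentiableOn ℝ (fun y => reducedHamiltonian Γ₁ Γ₂ C 0 y)
        {C / (Γ₁ + Γ₂)}ᶜ ∧
    Tendsto (fun y => reducedHamiltonian Γ₁ Γ₂ C 0 y)
        (nhdsWithin (C / (Γ₁ + Γ₂)) {C / (Γ₁ + Γ₂)}ᶜ) atTop ∧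
    Tendsto (fun y => reducedHamiltonian Γ₁ Γ₂ C 0 y) atTop atTop ∧
    Tendsto (fun y => reducedHamiltonian Γ₁ Γ₂ C 0 y) atBot atTop ∧
    ∃ ym yp : ℝ, ym < C / (Γ₁ + Γ₂) ∧ C / (Γ₁ + Γ₂) < yp ∧
      deriv (fun y => reducedHamiltonian Γ₁ Γ₂ C 0 y) ym = 0 ∧
      deriv (fun y => reducedHamiltonian Γ₁ Γ₂ C 0 y) yp = 0 := by
  have h1 : 0 < Γ₁ := h2.trans h12
  have hdiff := differentiableOn_reducedHamiltonian_zero C h1 h2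
  have hcoll := tendsto_reducedHamiltonian_zero_collision C h1 h2
  have htop := tendsto_reducedHamiltonian_zero_of_abs C h12 h2 tendsto_abs_atTop_atTop
  have hbot := tendsto_reducedHamiltonian_zero_of_abs C h12 h2 tendsto_abs_atBot_atTop
  refine ⟨hdiff, hcoll, htop, hbot, ?_⟩
  generalize C / (Γ₁ + Γ₂) = c at *
  generalize (fun y => reducedHamiltonian Γ₁ Γ₂ C 0 y) = g at *
  have hleft : Tendsto g (nhdsWithin c (Set.Iio c)) atTop :=
    hcoll.mono_left (nhdsWithin_mono c fun _ hy => ne_of_lt hy)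
  have hright : Tendsto g (nhdsWithin c (Set.Ioi c)) atTop :=
    hcoll.mono_left (nhdsWithin_mono c fun _ hy => ne_of_gt hy)
  have hm : ∃ ym < c, deriv g ym = 0 := by
    obtain ⟨q, hgq, hq⟩ := ((hleft.eventually_gt_atTop (g (c - 1))).and
      (Ioo_mem_nhdsLT (sub_one_lt c))).exists
    obtain ⟨p, hgp, hp⟩ := ((hbot.eventually_gt_atTop (g (c - 1))).and
      (eventually_lt_atBot (c - 1))).exists
    obtain ⟨z, hz, hz0⟩ := exists_deriv_eq_zero_of_lt_endpoints
      (hdiff.continuousOn.mono fun y hy => ne_of_lt (hy.2.trans_lt hq.2)) ⟨hp, hq.1⟩ hgp hgq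
    exact ⟨z, hz.2.trans hq.2, hz0⟩
  have hp : ∃ yp, c < yp ∧ deriv g yp = 0 := by
    obtain ⟨p, hgp, hp⟩ := ((hright.eventually_gt_atTop (g (c + 1))).and
      (Ioo_mem_nhdsGT (lt_add_one c))).exists
    obtain ⟨q, hgq, hq⟩ := ((htop.eventually_gt_atTop (g (c + 1))).and
      (eventually_gt_atTop (c + 1))).exists
    obtain ⟨z, hz, hz0⟩ := exists_deriv_eq_zero_of_lt_endpoints
      (hdiff.continuousOn.mono fun y hy => ne_of_gt (hp.1.trans_le hy.1)) ⟨hp.2, hq⟩ hgp hgq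
    exact ⟨z, hp.1.trans hz.1, hz0⟩
  obtain ⟨ym, hym, hym0⟩ := hm
  obtain ⟨yp, hyp, hyp0⟩ := hp
  exact ⟨ym, yp, hym, hyp, hym0, hyp0⟩
end

section
/- Let Γ > 0 and C ∈ ℝ, and let H(u,y) be the reduced two-vortex Hamiltonian on the Möbius band with equal strengths Γ₁ = Γ₂ = Γ and momentum value C. Then H(u, C/Γ − y) = H(u, y) for all real u, y; that is, when the two vortex strengths are equal the reduced Hamiltonian is symmetric with respect to the horizontal line y = C/(2Γ). -/
open Real

/-- For equal vortex strengths `Γ₁ = Γ₂ = Γ` the reduced Hamiltonian is symmetric with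
respect to the horizontal line `y = C/(2Γ)`. -/
theorem reducedHamiltonian_equal_strengths_symmetry (Γ C : ℝ) (hΓ : 0 < Γ) (u y : ℝ) :
    reducedHamiltonian Γ Γ C u (C / Γ - y) = reducedHamiltonian Γ Γ C u y := by
  have hne : Γ ≠ 0 := hΓ.ne'
  have h_sum : (C / Γ - y) / 2 * (1 + Γ / Γ) - C / (2 * Γ)
      = -(y / 2 * (1 + Γ / Γ) - C / (2 * Γ)) := by
    field_simp
    ring
  have h_diff : (C / Γ - y) / 2 * (1 - Γ / Γ) + C / (2 * Γ)
      = y / 2 * (1 - Γ / Γ) + C / (2 * Γ) := by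
    simp [hne]
  have h_swap : (C - Γ * (C / Γ - y)) / Γ = y := by
    field_simp
    ring
  have h_swap' : (C - Γ * y) / Γ = C / Γ - y := by
    field_simp
  unfold reducedHamiltonian
  rw [h_sum, h_diff, h_swap, h_swap', Real.sinh_neg, neg_sq]
  ring
end
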